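/- Let S be a numerical semigroup with minimal generators a_1 < … < a_ν and Frobenius number f, let u ∈ S be nonzero, and let ũ be the largest element of S that is strictly smaller than u. Then: (1) g(u) ≥ ⌈(f + u − ũ)/a_ν⌉; (2) g(a_ν) ≥ ⌈(f + a_ν − ã)/a_{ν−1}⌉, where ã is the largest element of S strictly smaller than a_ν; (3) τ ≥ ⌈f/a_ν⌉. -/

import Mathlib

namespace GotoNS

/-- `S` is a numerical semigroup: an additive submonoid of `ℕ` with finite
complement, different from `ℕ` itself. -/
def IsNumericalSemigroup (S : Set ℕ) : Prop :=
  (0 : ℕ) ∈ S ∧ (∀ a b, a ∈ S → b ∈ S → a + b ∈ S) ∧ Sᶜ.Finite ∧ S ≠ Set.univ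

/-- The multiplicity `e` of `S`: its smallest nonzero element. -/
noncomputable def mult (S : Set ℕ) : ℕ := sInf {n | n ∈ S ∧ n ≠ 0}

/-- The Frobenius number `f` of `S`: the largest integer not in `S`. -/
noncomputable def frob (S : Set ℕ) : ℕ := sSup {n | n ∉ S}

/-- The `k`-fold sumset `kM` of `M = S \ {0}` (with `0M = {0}`). -/
def kfold (S : Set ℕ) (k : ℕ) : Set ℕ :=
  {s | ∃ c : Fin k → ℕ, (∀ i, c i ∈ S ∧ c i ≠ 0) ∧ ∑ i, c i = s}

/-- The order of `s`: the largest `k` such that `s` is a sum of `k` nonzero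
elements of `S` (`ord 0 = 0`; junk value `0` off `S`). -/
noncomputable def ordS (S : Set ℕ) (s : ℕ) : ℕ := sSup {k | s ∈ kfold S k}

/-- The Apéry set `Ap(S; n) = {w ∈ S | w - n ∉ S}`. -/
def apery (S : Set ℕ) (n : ℕ) : Set ℕ := {w | w ∈ S ∧ ∀ s ∈ S, s + n ≠ w}

/-- `σ(α) = max {ord w | w ∈ Ap(S; α)}`. -/
noncomputable def sigmaS (S : Set ℕ) (α : ℕ) : ℕ := sSup (ordS S '' apery S α)

/-- `𝒜(u) = {α ∈ {1, …, e} | u - α ∈ S}`. -/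
def Aset (S : Set ℕ) (u : ℕ) : Set ℕ :=
  {α | 1 ≤ α ∧ α ≤ mult S ∧ ∃ s ∈ S, s + α = u}

/-- The Goto number `g(u) = min {σ(α) | α ∈ 𝒜(u)}`. -/
noncomputable def goto (S : Set ℕ) (u : ℕ) : ℕ := sInf (sigmaS S '' Aset S u)

/-- `τ`: the minimal Goto number of a nonzero element of `S`. -/
noncomputable def tau (S : Set ℕ) : ℕ := sInf (goto S '' {u | u ∈ S ∧ u ≠ 0})

/-- `ρ`: the maximal Goto number of a nonzero element of `S`. -/
noncomputable def rho (S : Set ℕ) : ℕ := sSup (goto S '' {u | u ∈ S ∧ u ≠ 0})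

/-- An integer belongs to `S` (viewed inside `ℤ`). -/
def memZ (S : Set ℕ) (z : ℤ) : Prop := ∃ n : ℕ, n ∈ S ∧ (n : ℤ) = z

/-- `T = {z ∈ ℤ \ S | z + u ∈ S for all 0 ≠ u ∈ S}`. -/
def Tset (S : Set ℕ) : Set ℤ :=
  {z | ¬ memZ S z ∧ ∀ u : ℕ, u ∈ S → u ≠ 0 → memZ S (z + (u : ℤ))}

open Classical in
/-- The order of an integer, with the convention `ord z = -1` if `z ∉ S`. -/
noncomputable def ordZ (S : Set ℕ) (z : ℤ) : ℤ :=
  if 0 ≤ z ∧ z.toNat ∈ S then (ordS S z.toNat : ℤ) else -1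

/-- `S` is symmetric: for integers `x + y = f`, exactly one of `x, y` lies in `S`. -/
def IsSymmetricNS (S : Set ℕ) : Prop :=
  ∀ x y : ℤ, x + y = (frob S : ℤ) → (memZ S x ↔ ¬ memZ S y)

/-- `u ⪯ u'` iff `u' - u ∈ S`. -/
def preceq (S : Set ℕ) (u u' : ℕ) : Prop := ∃ s ∈ S, u + s = u'

/-- `u ⪯_M u'` iff `u + s = u'` and `ord u + ord s = ord u'` for some `s ∈ S`. -/
def preceqM (S : Set ℕ) (u u' : ℕ) : Prop :=
  ∃ s ∈ S, u + s = u' ∧ ordS S u + ordS S s = ordS S u'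

/-- `Ap(S) \ {0}`. -/
def apNZ (S : Set ℕ) : Set ℕ := apery S (mult S) \ {0}

/-- Minimal elements of `Ap(S) \ {0}` with respect to `⪯`. -/
def minAp (S : Set ℕ) : Set ℕ := {w | w ∈ apNZ S ∧ ∀ w' ∈ apNZ S, preceq S w' w → w' = w}

/-- Maximal elements of `Ap(S) \ {0}` with respect to `⪯`. -/
def maxAp (S : Set ℕ) : Set ℕ := {w | w ∈ apNZ S ∧ ∀ w' ∈ apNZ S, preceq S w w' → w' = w}

/-- Minimal elements of `Ap(S) \ {0}` with respect to `⪯_M`. -/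
def minApM (S : Set ℕ) : Set ℕ := {w | w ∈ apNZ S ∧ ∀ w' ∈ apNZ S, preceqM S w' w → w' = w}

/-- Maximal elements of `Ap(S) \ {0}` with respect to `⪯_M`. -/
def maxApM (S : Set ℕ) : Set ℕ := {w | w ∈ apNZ S ∧ ∀ w' ∈ apNZ S, preceqM S w w' → w' = w}

/-- `S` is pure if all elements of `maxAp S` have the same order. -/
def IsPure (S : Set ℕ) : Prop := ∀ w ∈ maxAp S, ∀ w' ∈ maxAp S, ordS S w = ordS S w'

/-- `S` is `M`-pure if all elements of `maxApM S` have the same order. -/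
def IsMPure (S : Set ℕ) : Prop := ∀ w ∈ maxApM S, ∀ w' ∈ maxApM S, ordS S w = ordS S w'

/-- `S` is `M`-additive if `ord (u + a₁) = ord u + 1` for all `u ∈ S`. -/
def IsMAdditive (S : Set ℕ) : Prop := ∀ u ∈ S, ordS S (u + mult S) = ordS S u + 1

/-- The reduction number `r = min {k | (k+1)M = a₁ + kM}`. -/
noncomputable def redNum (S : Set ℕ) : ℕ :=
  sInf {k | kfold S (k + 1) = (fun x => mult S + x) '' kfold S k}

/-- The set of minimal generators of `S`: nonzero elements of `S` that are not
sums of two nonzero elements of `S`. -/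
def minGens (S : Set ℕ) : Set ℕ :=
  {a | a ∈ S ∧ a ≠ 0 ∧ ∀ x ∈ S, ∀ y ∈ S, x ≠ 0 → y ≠ 0 → x + y ≠ a}

/-- `δ_w = max {ord w + ord w' | w' ∈ S, w + w' ∈ Ap(S)}`. -/
noncomputable def deltaI (S : Set ℕ) (w : ℕ) : ℕ :=
  sSup ((fun w' => ordS S w + ordS S w') '' {w' | w' ∈ S ∧ w + w' ∈ apery S (mult S)})

/-- `δ = min {δ_w | w ∈ Ap(S)}`. -/
noncomputable def deltaNS (S : Set ℕ) : ℕ := sInf (deltaI S '' apery S (mult S))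

/-- `γ_w = max {ord w + ⌊w'/a₁⌋ | w' ∈ S, w + w' ∈ Ap(S)}`. -/
noncomputable def gammaI (S : Set ℕ) (w : ℕ) : ℕ :=
  sSup ((fun w' => ordS S w + w' / mult S) '' {w' | w' ∈ S ∧ w + w' ∈ apery S (mult S)})

/-- `γ = min {γ_w | w ∈ Ap(S)}`. -/
noncomputable def gammaNS (S : Set ℕ) : ℕ := sInf (gammaI S '' apery S (mult S))

/-- `ord(C) = min {ord (f+1), …, ord (f+a₁)}`. -/
noncomputable def ordC (S : Set ℕ) : ℕ :=
  sInf ((fun α => ordS S (frob S + α)) '' Set.Icc 1 (mult S))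


theorem kfold_add {S : Set ℕ} {k l x y : ℕ} (hx : x ∈ kfold S k) (hy : y ∈ kfold S l) :
    x + y ∈ kfold S (k + l) := by
  obtain ⟨c, hc, rfl⟩ := hx
  obtain ⟨d, hd, rfl⟩ := hy
  refine ⟨Fin.append c d, fun i => ?_, by simp [Fin.sum_univ_add]⟩
  refine Fin.addCases (fun i => ?_) (fun i => ?_) i
  · simpa using hc i
  · simpa using hd i

theorem le_of_mem_kfold {S : Set ℕ} {k s : ℕ} (h : s ∈ kfold S k) : k ≤ s := by
  obtain ⟨c, hc, rfl⟩ := h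
  calc k = ∑ _i : Fin k, 1 := by simp
    _ ≤ ∑ i, c i := Finset.sum_le_sum fun i _ => Nat.one_le_iff_ne_zero.2 (hc i).2

theorem le_ordS {S : Set ℕ} {k s : ℕ} (h : s ∈ kfold S k) : k ≤ ordS S s :=
  le_csSup ⟨s, fun _ hj => le_of_mem_kfold hj⟩ h

theorem ordS_le (S : Set ℕ) (s : ℕ) : ordS S s ≤ s :=
  csSup_le' fun _ hj => le_of_mem_kfold hj

/-- If every minimal generator that can be split off from `s` is at most `B`, then `s` is a sum
of `k` nonzero elements for some `k` with `s ≤ k * B`. -/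
theorem exists_mem_kfold_le_mul {S : Set ℕ} (hS : IsNumericalSemigroup S) {B s : ℕ} (hs : s ∈ S)
    (hB : ∀ g ∈ minGens S, ∀ t ∈ S, t + g = s → g ≤ B) :
    ∃ k, s ∈ kfold S k ∧ s ≤ k * B := by
  induction s using Nat.strong_induction_on with
  | _ s ih =>
    by_cases h0 : s = 0
    · subst h0
      exact ⟨0, ⟨Fin.elim0, fun i => i.elim0, by simp⟩, by simp⟩
    by_cases hg : s ∈ minGens S
    · exact ⟨1, ⟨fun _ => s, fun _ => ⟨hs, h0⟩, by simp⟩,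
        by simpa using hB s hg 0 hS.1 (zero_add s)⟩
    · obtain ⟨x, hx, y, hy, hx0, hy0, rfl⟩ :
          ∃ x ∈ S, ∃ y ∈ S, x ≠ 0 ∧ y ≠ 0 ∧ x + y = s := by
        by_contra! hne
        exact hg ⟨hs, h0, hne⟩
      obtain ⟨k, hk, hkB⟩ := ih x (by omega) hx fun g hg t ht h =>
        hB g hg (t + y) (hS.2.1 _ _ ht hy) (by omega)
      obtain ⟨l, hl, hlB⟩ := ih y (by omega) hy fun g hg t ht h =>
        hB g hg (x + t) (hS.2.1 _ _ hx ht) (by omega)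
      exact ⟨k + l, kfold_add hk hl, by rw [add_mul]; omega⟩

theorem le_ordS_mul {S : Set ℕ} (hS : IsNumericalSemigroup S) {B s : ℕ} (hs : s ∈ S)
    (hB : ∀ g ∈ minGens S, ∀ t ∈ S, t + g = s → g ≤ B) : s ≤ ordS S s * B := by
  obtain ⟨k, hk, hkB⟩ := exists_mem_kfold_le_mul hS hs hB
  exact hkB.trans (Nat.mul_le_mul_right _ (le_ordS hk))

theorem frob_notMem {S : Set ℕ} (hS : IsNumericalSemigroup S) : frob S ∉ S :=
  Nat.sSup_mem (Set.nonempty_compl.2 hS.2.2.2) hS.2.2.1.bddAbove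

theorem mem_of_frob_lt {S : Set ℕ} (hS : IsNumericalSemigroup S) {n : ℕ} (h : frob S < n) :
    n ∈ S := by
  by_contra hn
  exact absurd (le_csSup hS.2.2.1.bddAbove hn) (not_le.2 h)

theorem frob_add_mem_apery {S : Set ℕ} (hS : IsNumericalSemigroup S) {α : ℕ} (hα : 1 ≤ α) :
    frob S + α ∈ apery S α :=
  ⟨mem_of_frob_lt hS (by omega), fun s hs h =>
    frob_notMem hS (by rwa [← Nat.add_right_cancel h])⟩

theorem ordS_le_sigmaS {S : Set ℕ} (hS : IsNumericalSemigroup S) {α w : ℕ}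
    (hw : w ∈ apery S α) : ordS S w ≤ sigmaS S α := by
  refine le_csSup ⟨frob S + α, ?_⟩ ⟨w, hw, rfl⟩
  rintro _ ⟨v, hv, rfl⟩
  refine (ordS_le S v).trans ?_
  by_contra! h
  exact hv.2 (v - α) (mem_of_frob_lt hS (by omega)) (by omega)

theorem Aset_nonempty {S : Set ℕ} (hS : IsNumericalSemigroup S) {u : ℕ} (hu : u ∈ S)
    (hu0 : u ≠ 0) : (Aset S u).Nonempty := by
  have hm : mult S ∈ S ∧ mult S ≠ 0 :=
    Nat.sInf_mem (s := {n | n ∈ S ∧ n ≠ 0}) ⟨u, hu, hu0⟩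
  have hmul : ∀ q, q * mult S ∈ S := fun q => by
    induction q with
    | zero => simpa using hS.1
    | succ q ih => rw [add_mul, one_mul]; exact hS.2.1 _ _ ih hm.1
  have h1 := Nat.div_add_mod' (u - 1) (mult S)
  have h2 := Nat.mod_lt (u - 1) (Nat.pos_of_ne_zero hm.2)
  exact ⟨(u - 1) % mult S + 1, by omega, by omega, (u - 1) / mult S * mult S, hmul _, by omega⟩

/-- A lower bound for the Goto number of `u` from a bound `B` on the minimal generators that can
be split off from the elements `f + α` with `α ∈ 𝒜(u)`. -/
theorem ceil_le_goto {S : Set ℕ} (hS : IsNumericalSemigroup S) {u ut B : ℕ} (hu : u ∈ S)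
    (hu0 : u ≠ 0) (hutlt : ut < u) (hutmax : ∀ s ∈ S, s < u → s ≤ ut) (hB0 : 0 < B)
    (hB : ∀ α ∈ Aset S u, ∀ g ∈ minGens S, ∀ t ∈ S, t + g = frob S + α → g ≤ B) :
    (frob S + u - ut + B - 1) / B ≤ goto S u := by
  refine le_csInf ((Aset_nonempty hS hu hu0).image _) ?_
  rintro _ ⟨α, hα, rfl⟩
  have hap := frob_add_mem_apery hS hα.1
  refine le_trans ?_ (ordS_le_sigmaS hS hap)
  have hle := le_ordS_mul hS hap.1 (hB α hα)
  obtain ⟨h1, -, s, hs, rfl⟩ := hα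
  have := hutmax s hs (by omega)
  rw [← Nat.lt_add_one_iff, Nat.div_lt_iff_lt_mul hB0, add_mul, one_mul]
  omega

/-- lower bounds for Goto numbers (ceilings written as
`⌈x / y⌉ = (x + y - 1) / y` in `ℕ`). -/
theorem statement7 (S : Set ℕ) (hS : IsNumericalSemigroup S)
    (ν : ℕ) (a : Fin ν → ℕ) (ha : StrictMono a) (hgen : Set.range a = minGens S)
    (hν : 2 ≤ ν)
    (u : ℕ) (hu : u ∈ S) (hu0 : u ≠ 0)
    (ut : ℕ) (hut : ut ∈ S) (hutlt : ut < u) (hutmax : ∀ s ∈ S, s < u → s ≤ ut)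
    (av : ℕ) (hav : av ∈ S) (havlt : av < a ⟨ν - 1, by omega⟩)
    (havmax : ∀ s ∈ S, s < a ⟨ν - 1, by omega⟩ → s ≤ av) :
    (frob S + u - ut + a ⟨ν - 1, by omega⟩ - 1) / a ⟨ν - 1, by omega⟩ ≤ goto S u ∧
    (frob S + a ⟨ν - 1, by omega⟩ - av + a ⟨ν - 2, by omega⟩ - 1) / a ⟨ν - 2, by omega⟩ ≤
      goto S (a ⟨ν - 1, by omega⟩) ∧
    (frob S + a ⟨ν - 1, by omega⟩ - 1) / a ⟨ν - 1, by omega⟩ ≤ tau S := by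
  have hmem : ∀ i, a i ∈ minGens S := fun i => hgen ▸ Set.mem_range_self i
  have hpos : ∀ i, 0 < a i := fun i => Nat.pos_of_ne_zero (hmem i).2.1
  have hlast : ∀ g ∈ minGens S, g ≤ a ⟨ν - 1, by omega⟩ := by
    rw [← hgen]
    rintro _ ⟨i, rfl⟩
    exact ha.monotone (Fin.mk_le_mk.2 (by omega) : (⟨i, i.2⟩ : Fin ν) ≤ _)
  refine ⟨ceil_le_goto hS hu hu0 hutlt hutmax (hpos _) fun _ _ g hg _ _ _ => hlast g hg,
    ceil_le_goto hS (hmem _).1 (hmem _).2.1 havlt havmax (hpos _) ?_, ?_⟩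
  · rintro α ⟨-, -, s, hs, hsα⟩ g hg t ht htg
    rw [← hgen] at hg
    obtain ⟨i, rfl⟩ := hg
    refine ha.monotone (show (⟨i, i.2⟩ : Fin ν) ≤ _ from Fin.mk_le_mk.2 ?_)
    by_contra! hi
    have hieq : i = ⟨ν - 1, by omega⟩ := Fin.ext (by simp only; omega)
    rw [hieq] at htg
    exact frob_notMem hS ((show t + s = frob S by omega) ▸ hS.2.1 _ _ ht hs)
  · refine le_csInf (Set.Nonempty.image _ ⟨u, hu, hu0⟩) ?_
    rintro _ ⟨v, ⟨hv, hv0⟩, rfl⟩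
    have hpred : ∀ s ∈ S, s < v → s ≤ v - 1 := fun s _ h => by omega
    refine le_trans (Nat.div_le_div_right ?_) (ceil_le_goto hS hv hv0 (by omega) hpred (hpos _)
      fun _ _ g hg _ _ _ => hlast g hg)
    omega

end GotoNS
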